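/- For n ≥ 2, the polynomial f₀(x) = xₙ³ − 3xₙ(x₁² + … + x_{n−1}²) satisfies the eiconal equation |∇f₀(x)|² = 9|x|⁴ for all x ∈ ℝⁿ, and Δf₀(x) = 6(2−n)xₙ. In particular, for n ≥ 3, f₀ is not harmonic and hence not rotationally equivalent to any harmonic polynomial on ℝⁿ. -/

import Mathlib

open MvPolynomial

/-- The polynomial `f₀(x) = xₙ³ − 3xₙ(x₁² + ⋯ + x_{n−1}²)` on `ℝⁿ`. -/
noncomputable def simpleCubic' (n : ℕ) (hn : 2 ≤ n) : MvPolynomial (Fin n) ℝ :=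
  X (⟨n - 1, by omega⟩ : Fin n) ^ 3 -
    3 * X (⟨n - 1, by omega⟩ : Fin n) *
      ∑ i : Fin (n - 1), X (⟨i.1, by omega⟩ : Fin n) ^ 2

/-- Chain rule for substitution of polynomials into a multivariate polynomial. -/
theorem MvPolynomial.pderiv_bind₁ {R σ τ : Type*} [CommRing R] [Fintype σ]
    (φ : σ → MvPolynomial τ R) (j : τ) (g : MvPolynomial σ R) :
    pderiv j (bind₁ φ g) = ∑ i, bind₁ φ (pderiv i g) * pderiv j (φ i) := by
  classical
  induction g using MvPolynomial.induction_on with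
  | C a => simp
  | add p q hp hq => simp only [map_add, hp, hq, add_mul, Finset.sum_add_distrib]
  | mul_X p k hp =>
    simp only [map_mul, Derivation.leibniz, hp, bind₁_X_right, smul_eq_mul, pderiv_X, map_add,
      add_mul, Finset.sum_add_distrib, Finset.mul_sum, Pi.single_apply, apply_ite (bind₁ φ),
      map_zero, mul_ite, ite_mul, mul_one, mul_zero, zero_mul, Finset.sum_ite_eq,
      Finset.mem_univ, if_true, mul_assoc]

/-- The Laplacian commutes with substitution of an orthogonal change of variables. -/
theorem MvPolynomial.laplacian_bind₁_orthogonal {σ : Type*} [Fintype σ] [DecidableEq σ]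
    (U : Matrix σ σ ℝ) (hU : U ∈ Matrix.orthogonalGroup σ ℝ) (g : MvPolynomial σ ℝ) :
    ∑ j, pderiv j (pderiv j (bind₁ (fun i => ∑ j, C (U i j) * X j) g)) =
      bind₁ (fun i => ∑ j, C (U i j) * X j) (∑ i, pderiv i (pderiv i g)) := by
  have hφ (i j : σ) : pderiv j (∑ k, C (U i k) * X k : MvPolynomial σ ℝ) = C (U i j) := by
    simp [pderiv_X, Pi.single_apply]
  have hUU (i k : σ) : ∑ j, U k j * U i j = if k = i then 1 else 0 := by
    have h := congrFun (congrFun ((Matrix.mem_orthogonalGroup_iff _ _).mp hU) k) i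
    simpa [Matrix.mul_apply, Matrix.one_apply, Matrix.star_apply] using h
  have hC (i k : σ) (p : MvPolynomial σ ℝ) :
      ∑ j, p * C (U k j) * C (U i j) = if k = i then p else 0 := by
    simp only [mul_assoc, ← Finset.mul_sum, ← C_mul, ← map_sum, hUU]
    split_ifs <;> simp
  simp only [pderiv_bind₁, hφ, map_sum (pderiv _), map_sum (bind₁ _), pderiv_mul, pderiv_C,
    mul_zero, add_zero, Finset.sum_mul]
  rw [Finset.sum_comm]
  refine Finset.sum_congr rfl fun i _ => ?_
  rw [Finset.sum_comm]
  simp [hC]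

theorem simpleCubic'_succ (m : ℕ) (hn : 2 ≤ m + 1) :
    simpleCubic' (m + 1) hn =
      X (Fin.last m) ^ 3 - 3 * X (Fin.last m) * ∑ i : Fin m, X i.castSucc ^ 2 :=
  rfl

theorem pderiv_castSucc_simpleCubic' (m : ℕ) (hn : 2 ≤ m + 1) (j : Fin m) :
    pderiv j.castSucc (simpleCubic' (m + 1) hn) =
      C (-6) * X (Fin.last m) * X j.castSucc := by
  have h : Fin.last m ≠ j.castSucc := (Fin.castSucc_lt_last j).ne'
  have h3 : (3 : MvPolynomial (Fin (m + 1)) ℝ) = C 3 := (map_ofNat C 3).symm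
  simp [simpleCubic'_succ, h3, pderiv_X, Pi.single_apply, h]
  have h6 : (C 6 : MvPolynomial (Fin (m + 1)) ℝ) = 6 := map_ofNat C 6
  rw [h6, ← h3]
  ring

theorem pderiv_last_simpleCubic' (m : ℕ) (hn : 2 ≤ m + 1) :
    pderiv (Fin.last m) (simpleCubic' (m + 1) hn) =
      C 3 * X (Fin.last m) ^ 2 - C 3 * ∑ i : Fin m, X i.castSucc ^ 2 := by
  have h (j : Fin m) : j.castSucc ≠ Fin.last m := (Fin.castSucc_lt_last j).ne
  have h3 : (3 : MvPolynomial (Fin (m + 1)) ℝ) = C 3 := (map_ofNat C 3).symm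
  simp [simpleCubic'_succ, h3, pderiv_X, h]
  ring

theorem laplacian_simpleCubic' (n : ℕ) (hn : 2 ≤ n) :
    ∑ i, pderiv i (pderiv i (simpleCubic' n hn)) =
      C (6 * (2 - (n : ℝ))) * X (⟨n - 1, by omega⟩ : Fin n) := by
  obtain ⟨m, rfl⟩ : ∃ m, n = m + 1 := ⟨n - 1, by omega⟩
  have h (j : Fin m) : j.castSucc ≠ Fin.last m := (Fin.castSucc_lt_last j).ne
  change _ = C _ * X (Fin.last m)
  simp [Fin.sum_univ_castSucc, pderiv_castSucc_simpleCubic', pderiv_last_simpleCubic',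
    pderiv_X, h, fun j => (h j).symm]
  simp only [map_ofNat C 2, map_ofNat C 3, map_ofNat C 6]
  ring

theorem laplacian_simpleCubic'_ne_zero (n : ℕ) (hn : 3 ≤ n) :
    ∑ i, pderiv i (pderiv i (simpleCubic' n (by omega))) ≠ 0 := by
  have h : (3 : ℝ) ≤ n := by exact_mod_cast hn
  rw [laplacian_simpleCubic']
  refine mul_ne_zero ?_ (X_ne_zero _)
  rw [Ne, C_eq_zero]
  intro h0
  linarith

theorem eiconal_simpleCubic' (n : ℕ) (hn : 2 ≤ n) (x : Fin n → ℝ) :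
    ∑ i, (eval x (pderiv i (simpleCubic' n hn))) ^ 2 = 9 * (∑ i, x i ^ 2) ^ 2 := by
  obtain ⟨m, rfl⟩ : ∃ m, n = m + 1 := ⟨n - 1, by omega⟩
  simp only [Fin.sum_univ_castSucc, pderiv_castSucc_simpleCubic', pderiv_last_simpleCubic',
    map_sub, map_mul, map_sum, map_pow, eval_C, eval_X, mul_pow, ← Finset.mul_sum]
  ring

/-- For `n ≥ 2`, `f₀(x) = xₙ³ − 3xₙ(x₁² + ⋯ + x_{n−1}²)` satisfies the eiconal equation
`|∇f₀|² = 9|x|⁴` and `Δf₀ = 6(2 − n)xₙ`; for `n ≥ 3` it is not harmonic, hence not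
rotationally equivalent to any harmonic polynomial. -/
theorem simpleCubic_eiconal_laplacian (n : ℕ) (hn : 2 ≤ n) :
    (∀ x : Fin n → ℝ,
      ∑ i, (eval x (pderiv i (simpleCubic' n hn))) ^ 2 = 9 * (∑ i, x i ^ 2) ^ 2) ∧
    (∑ i, pderiv i (pderiv i (simpleCubic' n hn)) =
      C (6 * (2 - (n : ℝ))) * X (⟨n - 1, by omega⟩ : Fin n)) ∧
    (3 ≤ n →
      (∑ i, pderiv i (pderiv i (simpleCubic' n hn)) ≠ 0) ∧
      ∀ g : MvPolynomial (Fin n) ℝ, (∑ i, pderiv i (pderiv i g) = 0) →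
        ¬ ∃ U : Matrix (Fin n) (Fin n) ℝ, U ∈ Matrix.orthogonalGroup (Fin n) ℝ ∧
          ∀ x : Fin n → ℝ, eval x (simpleCubic' n hn) = eval (U.mulVec x) g) := by
  refine ⟨eiconal_simpleCubic' n hn, laplacian_simpleCubic' n hn, fun h3 =>
    ⟨laplacian_simpleCubic'_ne_zero n h3, ?_⟩⟩
  rintro g hg ⟨U, hU, h⟩
  apply laplacian_simpleCubic'_ne_zero n h3
  have hf : simpleCubic' n hn = bind₁ (fun i => ∑ j, C (U i j) * X j) g := by
    refine MvPolynomial.funext fun x => ?_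
    rw [h x, ← aeval_eq_eval, ← aeval_eq_eval, aeval_bind₁]
    congr 2
    ext i
    simp [Matrix.mulVec, dotProduct]
  rw [hf, laplacian_bind₁_orthogonal U hU, hg, map_zero]
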